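/- Let S be a simple system over R = F[x₁,…,x_n] such that for every k = 1,…,n the set S_{x_k} consists of an equation. Then Sol(S) ⊆ F̄ⁿ is finite and has exactly ∏_{k=1}^{n} mdeg(S_{x_k}) elements. -/

import Mathlib

open MvPolynomial

/-- An algebraic system over `F[x₁,…,xₙ]`: a finite set of equations `p = 0`
and a finite set of inequations `p ≠ 0`. -/
structure AlgSystem (F : Type*) [Field F] (n : ℕ) where
  eqs : Finset (MvPolynomial (Fin n) F)
  ineqs : Finset (MvPolynomial (Fin n) F)

variable {F : Type*} [Field F] [CharZero F] {n : ℕ}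

/-- `k` is the leader of `p`: the largest variable occurring in `p`. -/
def IsLeader (p : MvPolynomial (Fin n) F) (k : Fin n) : Prop :=
  k ∈ p.vars ∧ ∀ j ∈ p.vars, j ≤ k

/-- membership of a polynomial in a system (as an equation or an inequation). -/
def AlgSystem.Mem (S : AlgSystem F n) (p : MvPolynomial (Fin n) F) : Prop :=
  p ∈ S.eqs ∨ p ∈ S.ineqs

/-- `a ∈ Sol(S)`: `a` satisfies all equations and inequations of `S`. -/
def Sol (S : AlgSystem F n) (a : Fin n → AlgebraicClosure F) : Prop :=
  (∀ p ∈ S.eqs, aeval a p = 0) ∧ (∀ p ∈ S.ineqs, aeval a p ≠ 0)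

/-- `a` is a solution of the subsystem `S_{<x_k}` of all members of `S` whose
variables are all `< x_k` (only the coordinates `< k` of `a` matter). -/
def SolBelow (S : AlgSystem F n) (k : Fin n) (a : Fin n → AlgebraicClosure F) : Prop :=
  (∀ p ∈ S.eqs, (∀ j ∈ p.vars, j < k) → aeval a p = 0) ∧
  (∀ p ∈ S.ineqs, (∀ j ∈ p.vars, j < k) → aeval a p ≠ 0)

/-- `a` is a solution of the subsystem `S_{≤x_k}` of all members of `S` whose
variables are all `≤ x_k` (only the coordinates `≤ k` of `a` matter). -/
def SolUpTo (S : AlgSystem F n) (k : Fin n) (a : Fin n → AlgebraicClosure F) : Prop :=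
  (∀ p ∈ S.eqs, (∀ j ∈ p.vars, j ≤ k) → aeval a p = 0) ∧
  (∀ p ∈ S.ineqs, (∀ j ∈ p.vars, j ≤ k) → aeval a p ≠ 0)

/-- `φ_{<x_k,a}(p)`: the univariate polynomial over `F̄` obtained from `p` by
substituting `a i` for `x_i` (`i ≠ k`) and keeping `x_k` as the variable. -/
noncomputable def uni (a : Fin n → AlgebraicClosure F) (k : Fin n)
    (p : MvPolynomial (Fin n) F) : Polynomial (AlgebraicClosure F) :=
  aeval (fun i => if i = k then (Polynomial.X : Polynomial (AlgebraicClosure F))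
    else Polynomial.C (a i)) p

/-- The initial of `p` with respect to the variable `x_k`: the leading coefficient
of `p` regarded as a univariate polynomial in `x_k`. -/
noncomputable def initOf (p : MvPolynomial (Fin n) F) (k : Fin n) :
    MvPolynomial (Fin n) F :=
  ∑ m ∈ p.support.filter (fun m => m k = p.degreeOf k),
    monomial (m.erase k) (coeff m p)

/-- Triangularity: at most one member of `S` has leader `x_k`, for each `k`,
and `S` contains no constant polynomial. -/
def Triangular (S : AlgSystem F n) : Prop :=
  (∀ k : Fin n, ∀ p, S.Mem p → ∀ q, S.Mem q → IsLeader p k → IsLeader q k → p = q) ∧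
  (∀ k : Fin n, ∀ p, IsLeader p k → ¬(p ∈ S.eqs ∧ p ∈ S.ineqs)) ∧
  (∀ p, S.Mem p → p.vars.Nonempty)

/-- Non-vanishing initials: for every member `p` of `S` with leader `x_k` and every
solution `a` of `S_{<x_k}`, `init(p)` does not vanish at `a`. -/
def NonVanishingInitials (S : AlgSystem F n) : Prop :=
  ∀ k : Fin n, ∀ p, S.Mem p → IsLeader p k →
    ∀ a : Fin n → AlgebraicClosure F, SolBelow S k a → aeval a (initOf p k) ≠ 0

/-- Square-freeness: for every member `p` of `S` with leader `x_k` and every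
solution `a` of `S_{<x_k}`, the univariate polynomial `φ_{<x_k,a}(p)` is squarefree. -/
def SquarefreeCond (S : AlgSystem F n) : Prop :=
  ∀ k : Fin n, ∀ p, S.Mem p → IsLeader p k →
    ∀ a : Fin n → AlgebraicClosure F, SolBelow S k a → Squarefree (uni a k p)

/-- A simple system. -/
def Simple (S : AlgSystem F n) : Prop :=
  Triangular S ∧ NonVanishingInitials S ∧ SquarefreeCond S


theorem uni_monomial_aux (a : Fin n → AlgebraicClosure F) (k : Fin n) (m : Fin n →₀ ℕ) (c : F) :
    uni a k (monomial m c) =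
      Polynomial.C (aeval a (monomial (m.erase k) c)) * Polynomial.X ^ (m k) := by
  unfold uni
  rw [aeval_monomial, aeval_monomial]
  rw [← Finsupp.mul_prod_erase' m k _ (by simp)]
  have h : (m.erase k).prod (fun i e => (if i = k then (Polynomial.X : Polynomial (AlgebraicClosure F))
      else Polynomial.C (a i)) ^ e) = Polynomial.C ((m.erase k).prod (fun i e => a i ^ e)) := by
    rw [Finsupp.prod, Finsupp.prod, map_prod]
    refine Finset.prod_congr rfl fun i hi => ?_
    have : i ≠ k := by
      rintro rfl
      simp at hi
    simp [this]
  rw [h, map_mul]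
  simp only [if_true]
  rw [IsScalarTower.algebraMap_apply F (AlgebraicClosure F) (Polynomial (AlgebraicClosure F))]
  rw [← Polynomial.C_eq_algebraMap]
  ring

theorem uni_eq_sum_aux (a : Fin n → AlgebraicClosure F) (k : Fin n) (p : MvPolynomial (Fin n) F) :
    uni a k p = ∑ m ∈ p.support,
      Polynomial.C (aeval a (monomial (m.erase k) (coeff m p))) * Polynomial.X ^ (m k) := by
  conv_lhs => rw [p.as_sum]
  simp_rw [← uni_monomial_aux]
  unfold uni
  rw [map_sum]

theorem uni_coeff_aux (a : Fin n → AlgebraicClosure F) (k : Fin n) (p : MvPolynomial (Fin n) F) :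
    (uni a k p).coeff (p.degreeOf k) = aeval a (initOf p k) := by
  rw [uni_eq_sum_aux, Polynomial.finset_sum_coeff, initOf, map_sum, Finset.sum_filter]
  refine Finset.sum_congr rfl fun m _ => ?_
  rw [Polynomial.coeff_C_mul_X_pow]
  simp only [eq_comm]

theorem uni_natDegree_le_aux (a : Fin n → AlgebraicClosure F) (k : Fin n)
    (p : MvPolynomial (Fin n) F) : (uni a k p).natDegree ≤ p.degreeOf k := by
  rw [uni_eq_sum_aux]
  refine Polynomial.natDegree_sum_le_of_forall_le _ _ fun m hm => ?_
  refine (Polynomial.natDegree_C_mul_X_pow_le _ _).trans ?_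
  exact monomial_le_degreeOf k hm

theorem uni_eval_aux (a : Fin n → AlgebraicClosure F) (k : Fin n)
    (p : MvPolynomial (Fin n) F) (x : AlgebraicClosure F) :
    (uni a k p).eval x = aeval (Function.update a k x) p := by
  unfold uni
  rw [← Polynomial.coe_aeval_eq_eval, ← AlgHom.restrictScalars_apply F, ← AlgHom.comp_apply,
    comp_aeval]
  congr 2
  funext i
  by_cases h : i = k
  · subst h; simp
  · simp [h]

theorem root_set_aux (a : Fin n → AlgebraicClosure F) (k : Fin n)
    (p : MvPolynomial (Fin n) F) (h1 : aeval a (initOf p k) ≠ 0) (h2 : Squarefree (uni a k p)) :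
    ∃ s : Finset (AlgebraicClosure F), (∀ x, x ∈ s ↔ aeval (Function.update a k x) p = 0) ∧
      s.card = p.degreeOf k := by
  classical
  have hd : (uni a k p).natDegree = p.degreeOf k := by
    refine le_antisymm (uni_natDegree_le_aux a k p) (Polynomial.le_natDegree_of_ne_zero ?_)
    rwa [uni_coeff_aux]
  have h0 : uni a k p ≠ 0 := h2.ne_zero
  refine ⟨(uni a k p).roots.toFinset, fun x => ?_, ?_⟩
  · rw [Multiset.mem_toFinset, Polynomial.mem_roots h0, Polynomial.IsRoot, uni_eval_aux]
  · rw [Multiset.toFinset_card_of_nodup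
      (Polynomial.nodup_roots (PerfectField.separable_iff_squarefree.mpr h2)), ← hd]
    exact (IsAlgClosed.splits _).natDegree_eq_card_roots.symm

theorem count_aux {K : Type*} [Zero K] (P : Fin n → (Fin n → K) → Prop) (d : Fin n → ℕ)
    (hP : ∀ k a b, (∀ j ≤ k, a j = b j) → P k a → P k b)
    (hd : ∀ k a, (∀ j < k, P j a) →
      ∃ s : Finset K, (∀ x, x ∈ s ↔ P k (Function.update a k x)) ∧ s.card = d k)
    (j : ℕ) (hj : j ≤ n) :
    ∃ T : Finset (Fin n → K),
      (∀ a, a ∈ T ↔ (∀ i : Fin n, i.1 < j → P i a) ∧ ∀ i : Fin n, j ≤ i.1 → a i = 0) ∧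
      T.card = ∏ i ∈ Finset.univ.filter (fun i : Fin n => i.1 < j), d i := by
  classical
  induction j with
  | zero =>
    refine ⟨{0}, fun a => ?_, by simp⟩
    simp [funext_iff]
  | succ j ih =>
    obtain ⟨T, hT, hc⟩ := ih (by omega)
    let k : Fin n := ⟨j, by omega⟩
    have hk : k.1 = j := rfl
    have key : ∀ a : Fin n → K, ∃ s : Finset K, a ∈ T →
        ((∀ x, x ∈ s ↔ P k (Function.update a k x)) ∧ s.card = d k) := by
      intro a
      by_cases ha : a ∈ T
      · obtain ⟨s, hs⟩ := hd k a (fun i hi => ((hT a).1 ha).1 i hi)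
        exact ⟨s, fun _ => hs⟩
      · exact ⟨∅, fun h => absurd h ha⟩
    choose s hs using key
    refine ⟨T.biUnion fun a => (s a).image (Function.update a k), fun b => ?_, ?_⟩
    · rw [Finset.mem_biUnion]
      constructor
      · rintro ⟨a, ha, hb⟩
        obtain ⟨x, hx, rfl⟩ := Finset.mem_image.1 hb
        have hTa := (hT a).1 ha
        refine ⟨fun i hi => ?_, fun i hi => ?_⟩
        · by_cases hik : i = k
          · rw [hik]; exact ((hs a ha).1 x).1 hx
          · have hne : i.1 ≠ j := fun h => hik (Fin.ext h)
            refine hP i a _ (fun l hl => ?_) (hTa.1 i (by omega))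
            have hl' : l.1 ≤ i.1 := hl
            rw [Function.update_of_ne]
            intro h
            rw [h] at hl'
            omega
        · rw [Function.update_of_ne]
          · exact hTa.2 i (by omega)
          · intro h
            rw [h] at hi
            omega
      · rintro ⟨h1, h2⟩
        have ha : Function.update b k 0 ∈ T := by
          refine (hT _).2 ⟨fun i hi => ?_, fun i hi => ?_⟩
          · refine hP i b _ (fun l hl => ?_) (h1 i (by omega))
            have hl' : l.1 ≤ i.1 := hl
            rw [Function.update_of_ne]
            intro h
            rw [h] at hl'
            omega
          · by_cases hik : i = k
            · rw [hik]; simp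
            · have hne : i.1 ≠ j := fun h => hik (Fin.ext h)
              rw [Function.update_of_ne hik]
              exact h2 i (by omega)
        refine ⟨_, ha, Finset.mem_image.2 ⟨b k, ?_, by simp⟩⟩
        rw [(hs _ ha).1]
        simpa using h1 k (by omega)
    · rw [Finset.card_biUnion]
      · have hf : Finset.univ.filter (fun i : Fin n => i.1 < j + 1) =
            insert k (Finset.univ.filter (fun i : Fin n => i.1 < j)) := by
          ext i
          simp only [Finset.mem_filter, Finset.mem_univ, true_and, Finset.mem_insert, Fin.ext_iff]
          omega
        rw [hf, Finset.prod_insert (by simp [hk]), ← hc, mul_comm, ← smul_eq_mul,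
          ← Finset.sum_const]
        refine Finset.sum_congr rfl fun a ha => ?_
        rw [Finset.card_image_of_injective _ (Function.update_injective a k), (hs a ha).2]
      · intro a ha b hb hab
        rw [Function.onFun, Finset.disjoint_left]
        intro c hc1 hc2
        obtain ⟨x, -, rfl⟩ := Finset.mem_image.1 hc1
        obtain ⟨y, -, hy⟩ := Finset.mem_image.1 hc2
        apply hab
        funext i
        by_cases hik : i = k
        · rw [hik, ((hT a).1 ha).2 k le_rfl, ((hT b).1 hb).2 k le_rfl]
        · have := congrFun hy i
          rw [Function.update_of_ne hik, Function.update_of_ne hik] at this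
          exact this.symm

theorem leader_aux (S : AlgSystem F n) (hS : Simple S)
    (g : Fin n → MvPolynomial (Fin n) F)
    (hg : ∀ k : Fin n, g k ∈ S.eqs ∧ IsLeader (g k) k)
    (p : MvPolynomial (Fin n) F) (hp : S.Mem p) : ∃ k ∈ p.vars, p = g k := by
  have hne := hS.1.2.2 p hp
  have hl : IsLeader p (p.vars.max' hne) :=
    ⟨Finset.max'_mem _ _, fun j hj => Finset.le_max' _ _ hj⟩
  exact ⟨_, hl.1, hS.1.1 _ p hp _ (Or.inl (hg _).1) hl (hg _).2⟩

theorem ineq_aux (S : AlgSystem F n) (hS : Simple S)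
    (g : Fin n → MvPolynomial (Fin n) F)
    (hg : ∀ k : Fin n, g k ∈ S.eqs ∧ IsLeader (g k) k)
    (p : MvPolynomial (Fin n) F) (hp : p ∈ S.ineqs) : False := by
  obtain ⟨k, -, rfl⟩ := leader_aux S hS g hg p (Or.inr hp)
  exact hS.1.2.1 k _ (hg k).2 ⟨(hg k).1, hp⟩

/-- If `S` is a simple system such that for each `k` the set `S_{x_k}` consists of
an equation `g k = 0`, then `Sol(S)` is finite with exactly `∏ₖ mdeg(g k)` elements. -/
theorem simple_zero_dimensional_card (S : AlgSystem F n) (hS : Simple S)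
    (g : Fin n → MvPolynomial (Fin n) F)
    (hg : ∀ k : Fin n, g k ∈ S.eqs ∧ IsLeader (g k) k) :
    {a : Fin n → AlgebraicClosure F | Sol S a}.Finite ∧
      {a : Fin n → AlgebraicClosure F | Sol S a}.ncard = ∏ k : Fin n, (g k).degreeOf k := by
  obtain ⟨T, hT, hc⟩ := count_aux (K := AlgebraicClosure F)
    (fun k a => aeval a (g k) = 0) (fun k => (g k).degreeOf k)
    (by
      intro k a b hab h
      rw [← h]
      refine eval₂Hom_congr' rfl (fun i hi _ => ?_) rfl
      exact (hab i ((hg k).2.2 i hi)).symm)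
    (by
      intro k a h
      have hb : SolBelow S k a := by
        refine ⟨fun p hp hv => ?_, fun p hp => (ineq_aux S hS g hg p hp).elim⟩
        obtain ⟨i, hi, rfl⟩ := leader_aux S hS g hg p (Or.inl hp)
        exact h i (hv i hi)
      exact root_set_aux a k (g k) (hS.2.1 k _ (Or.inl (hg k).1) (hg k).2 a hb)
        (hS.2.2 k _ (Or.inl (hg k).1) (hg k).2 a hb))
    n le_rfl
  have hST : {a : Fin n → AlgebraicClosure F | Sol S a} = ↑T := by
    ext a
    rw [Set.mem_setOf_eq, Finset.mem_coe, hT]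
    constructor
    · intro h
      exact ⟨fun i _ => h.1 _ (hg i).1, fun i hi => absurd i.2 (by omega)⟩
    · rintro ⟨h, -⟩
      refine ⟨fun p hp => ?_, fun p hp => (ineq_aux S hS g hg p hp).elim⟩
      obtain ⟨i, hi, rfl⟩ := leader_aux S hS g hg p (Or.inl hp)
      exact h i i.2
  rw [hST]
  refine ⟨T.finite_toSet, ?_⟩
  rw [Set.ncard_coe_finset, hc]
  refine Finset.prod_congr ?_ fun _ _ => rfl
  ext i
  simp
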